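/- Let R be a (2^k − 1)-ΔU ring for some k ≥ 1. The following are equivalent: (i) R is semi-regular; (ii) R is an exchange ring; (iii) R is a clean ring. -/

import Mathlib

/-- `Δ(R)`: the set of elements `a` such that `1 - ua` is a unit for every unit `u`. -/
def Delta (R : Type*) [Ring R] : Set R :=
  {a : R | ∀ u : Rˣ, IsUnit (1 - (u : R) * a)}

/-- A ring `R` is `n`-ΔU if `uⁿ - 1 ∈ Δ(R)` for every unit `u` of `R`. -/
def IsNDeltaU (R : Type*) [Ring R] (n : ℕ) : Prop :=
  ∀ u : Rˣ, ((u : R) ^ n - 1) ∈ Delta R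

/-- A ring is exchange if for each `a` there is an idempotent `e ∈ aR` with
`1 - e ∈ (1 - a)R`. -/
def IsExchangeRing (R : Type*) [Ring R] : Prop :=
  ∀ a : R, ∃ e : R, IsIdempotentElem e ∧ (∃ r : R, e = a * r) ∧
    (∃ s : R, 1 - e = (1 - a) * s)

/-- A ring is clean if every element is the sum of an idempotent and a unit. -/
def IsCleanRing (R : Type*) [Ring R] : Prop :=
  ∀ a : R, ∃ e u : R, IsIdempotentElem e ∧ IsUnit u ∧ a = e + u

/-- A ring is semi-regular if `R/J(R)` is von Neumann regular and idempotents lift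
modulo the Jacobson radical `J(R)`. -/
def IsSemiregularRing (R : Type*) [Ring R] : Prop :=
  (∀ a : R, ∃ x : R, a * x * a - a ∈ TwoSidedIdeal.jacobson (⊥ : TwoSidedIdeal R)) ∧
  (∀ a : R, a ^ 2 - a ∈ TwoSidedIdeal.jacobson (⊥ : TwoSidedIdeal R) →
    ∃ e : R, IsIdempotentElem e ∧ e - a ∈ TwoSidedIdeal.jacobson (⊥ : TwoSidedIdeal R))

/-- Jacobson's lemma: `1 - ba` is a unit whenever `1 - ab` is. -/
theorem isUnit_one_sub_mul_swap {R : Type*} [Ring R] {a b : R} (h : IsUnit (1 - a * b)) :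
    IsUnit (1 - b * a) := by
  obtain ⟨t, h1, h2⟩ := isUnit_iff_exists.1 h
  refine isUnit_iff_exists.2 ⟨1 + b * t * a, ?_, ?_⟩
  · linear_combination (norm := noncomm_ring) b * h1 * a
  · linear_combination (norm := noncomm_ring) b * h2 * a

/-- The Jacobson radical as a two-sided ideal. -/
abbrev jacobsonRadical (R : Type*) [Ring R] : TwoSidedIdeal R :=
  TwoSidedIdeal.jacobson (⊥ : TwoSidedIdeal R)

section Jacobson

variable {R : Type*} [Ring R]

theorem exists_left_inverse_of_mem_jacobsonRadical {x : R} (hx : x ∈ jacobsonRadical R) :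
    ∃ z, z * (1 - x) = 1 := by
  obtain ⟨z, hz⟩ := TwoSidedIdeal.mem_jacobson_iff.1 hx (-1)
  rw [TwoSidedIdeal.mem_bot] at hz
  exact ⟨z, by linear_combination (norm := noncomm_ring) hz⟩

theorem isUnit_one_sub_of_mem_jacobsonRadical {x : R} (hx : x ∈ jacobsonRadical R) :
    IsUnit (1 - x) := by
  obtain ⟨z, hz⟩ := exists_left_inverse_of_mem_jacobsonRadical hx
  obtain ⟨w, hw⟩ := exists_left_inverse_of_mem_jacobsonRadical
    ((jacobsonRadical R).neg_mem ((jacobsonRadical R).mul_mem_left z x hx))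
  have hzx : 1 - -(z * x) = z := by linear_combination (norm := noncomm_ring) -hz
  rw [hzx] at hw
  have hwx : w = 1 - x := left_inv_eq_right_inv hw hz
  exact isUnit_iff_exists.2 ⟨z, hwx ▸ hw, hz⟩

theorem mem_jacobsonRadical_of_forall_isUnit {x : R} (hx : ∀ r, IsUnit (1 - r * x)) :
    x ∈ jacobsonRadical R := by
  refine TwoSidedIdeal.mem_jacobson_iff.2 fun y ↦ ?_
  obtain ⟨z, -, hz⟩ := isUnit_iff_exists.1 (hx (-y))
  refine ⟨z, ?_⟩
  rw [TwoSidedIdeal.mem_bot]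
  linear_combination (norm := noncomm_ring) hz

/-- The quotient map modulo the Jacobson radical. -/
abbrev modJacobson (R : Type*) [Ring R] : R →+* (jacobsonRadical R).ringCon.Quotient :=
  (jacobsonRadical R).ringCon.mk'

theorem modJacobson_eq_zero_iff {x : R} : modJacobson R x = 0 ↔ x ∈ jacobsonRadical R := by
  rw [← TwoSidedIdeal.mem_ker, TwoSidedIdeal.ker_ringCon_mk']

theorem modJacobson_surjective : Function.Surjective (modJacobson R) :=
  RingCon.mk'_surjective _

theorem isUnit_of_modJacobson_eq_one {x : R} (hx : modJacobson R x = 1) : IsUnit x := by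
  have h : IsUnit (1 - (1 - x)) := isUnit_one_sub_of_mem_jacobsonRadical <|
    modJacobson_eq_zero_iff.1 (by rw [map_sub, map_one, hx, sub_self])
  rwa [sub_sub_cancel] at h

theorem isUnit_of_isUnit_modJacobson {x : R} (hx : IsUnit (modJacobson R x)) : IsUnit x := by
  obtain ⟨t, h1, h2⟩ := isUnit_iff_exists.1 hx
  obtain ⟨y, rfl⟩ := modJacobson_surjective t
  rw [← map_mul] at h1 h2
  obtain ⟨p, hp, -⟩ := isUnit_iff_exists.1 (isUnit_of_modJacobson_eq_one h1)
  obtain ⟨s, -, hs⟩ := isUnit_iff_exists.1 (isUnit_of_modJacobson_eq_one h2)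
  rw [mul_assoc] at hp
  rw [← mul_assoc] at hs
  have := left_inv_eq_right_inv hs hp
  exact isUnit_iff_exists.2 ⟨y * p, hp, this ▸ hs⟩

/-- An idempotent whose complement is a unit is zero. -/
theorem IsIdempotentElem.eq_zero_of_isUnit_one_sub {e : R} (he : IsIdempotentElem e)
    (hu : IsUnit (1 - e)) : e = 0 :=
  hu.mul_right_eq_zero.1 (by rw [sub_mul, one_mul, he.eq, sub_self])

end Jacobson

namespace Delta

variable {R : Type*} [Ring R] {a b : R}

theorem isUnit_sub (ha : a ∈ Delta R) {u : R} (hu : IsUnit u) : IsUnit (u - a) := by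
  obtain ⟨u, rfl⟩ := hu
  have h : (u : R) - a = u * (1 - (u⁻¹ : Rˣ) * a) := by
    rw [mul_sub, mul_one, Units.mul_inv_cancel_left]
  exact h ▸ u.isUnit.mul (ha u⁻¹)

theorem unit_mul_mem (ha : a ∈ Delta R) {u : R} (hu : IsUnit u) : u * a ∈ Delta R := by
  obtain ⟨u, rfl⟩ := hu
  intro v
  simpa [mul_assoc] using ha (v * u)

theorem mul_unit_mem (ha : a ∈ Delta R) {u : R} (hu : IsUnit u) : a * u ∈ Delta R := by
  obtain ⟨u, rfl⟩ := hu
  intro v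
  rw [← mul_assoc]
  apply isUnit_one_sub_mul_swap
  simpa [mul_assoc] using ha (u * v)

theorem add_mem (ha : a ∈ Delta R) (hb : b ∈ Delta R) : a + b ∈ Delta R := fun u ↦ by
  rw [mul_add, ← sub_sub]
  exact isUnit_sub (unit_mul_mem hb u.isUnit) (ha u)

theorem neg_mem (ha : a ∈ Delta R) : -a ∈ Delta R := by
  simpa using unit_mul_mem ha (isUnit_one.neg)

theorem sub_mem (ha : a ∈ Delta R) (hb : b ∈ Delta R) : a - b ∈ Delta R :=
  sub_eq_add_neg a b ▸ add_mem ha (neg_mem hb)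

theorem mul_mem (ha : a ∈ Delta R) (hb : b ∈ Delta R) : a * b ∈ Delta R := by
  have h := sub_mem hb (unit_mul_mem hb (isUnit_sub ha isUnit_one))
  rwa [sub_mul, one_mul, sub_sub_cancel] at h

theorem natCast_mul_mem (ha : a ∈ Delta R) (m : ℕ) : (m : R) * a ∈ Delta R := by
  induction m with
  | zero => intro u; simp
  | succ m ih => rw [Nat.cast_succ, add_mul, one_mul]; exact add_mem ih ha

end Delta

section Implications

variable {R : Type*} [Ring R]

theorem IsCleanRing.isExchangeRing (h : IsCleanRing R) : IsExchangeRing R := by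
  intro a
  obtain ⟨e, u, he, hu, rfl⟩ := h a
  obtain ⟨v, huv, hvu⟩ := isUnit_iff_exists.1 hu
  have he' := he.eq
  have hf : (1 - e) * (1 - e) = 1 - e := he.one_sub.eq
  refine ⟨u * (1 - e) * v, ?_, ⟨(1 - e) * v, ?_⟩, ⟨-(e * v), ?_⟩⟩
  · calc u * (1 - e) * v * (u * (1 - e) * v) = u * (1 - e) * (v * u) * (1 - e) * v := by
          noncomm_ring
      _ = u * ((1 - e) * (1 - e)) * v := by rw [hvu]; noncomm_ring
      _ = u * (1 - e) * v := by rw [hf]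
  · linear_combination (norm := noncomm_ring) he' * v
  · linear_combination (norm := noncomm_ring) -huv - he' * v

theorem IsSemiregularRing.isExchangeRing (h : IsSemiregularRing R) : IsExchangeRing R := by
  intro a
  obtain ⟨x, hx⟩ := h.1 a
  set q := modJacobson R with hq
  have hx' : q a * q x * q a = q a := by
    have := modJacobson_eq_zero_iff.2 hx
    rwa [map_sub, map_mul, map_mul, sub_eq_zero] at this
  set r := 1 + x - a * x with hr
  set s := 1 - a * x with hs
  have hrs : a * r = 1 - (1 - a) * s := by rw [hr, hs]; noncomm_ring
  have hidem : q (a * r) * q (a * r) = q (a * r) := by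
    simp only [hr, map_mul, map_sub, map_add, map_one]
    linear_combination (norm := noncomm_ring)
      (1 - q a) * hx' * q x + (1 - q a) * hx' * (1 - q a * q x)
  obtain ⟨e, he, hea⟩ := h.2 (a * r) (modJacobson_eq_zero_iff.1 (by
    rw [pow_two, map_sub, map_mul (modJacobson R) (a * r), hidem, sub_self]))
  have hqe : q e = q (a * r) := sub_eq_zero.1 (by
    rw [← map_sub]; exact modJacobson_eq_zero_iff.2 hea)
  have he' := he.eq
  obtain ⟨v, hwv, hvw⟩ := isUnit_iff_exists.1 (isUnit_of_modJacobson_eq_one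
    (x := a * r * e + (1 - a) * s * (1 - e)) (by
      have h1 : q ((1 - a) * s) = 1 - q e := by
        rw [hqe, hrs, map_sub, map_one, sub_sub_cancel]
      have h2 : q e * q e = q e := by rw [← map_mul, he']
      rw [← hq, map_add, map_mul q (a * r), map_mul q ((1 - a) * s), ← hqe, h1, map_sub, map_one]
      linear_combination (norm := noncomm_ring) (2 : ℤ) • h2))
  set w := a * r * e + (1 - a) * s * (1 - e) with hw
  have hwe : w * e = a * r * e := by
    rw [hw]; linear_combination (norm := noncomm_ring) a * r * he' - (1 - a) * s * he'
  have hwe' : w * (1 - e) = (1 - a) * s * (1 - e) := by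
    rw [mul_sub, mul_one, hwe, hw]; noncomm_ring
  refine ⟨w * e * v, ?_, ⟨r * e * v, ?_⟩, ⟨s * (1 - e) * v, ?_⟩⟩
  · calc w * e * v * (w * e * v) = w * e * (v * w) * e * v := by noncomm_ring
      _ = w * (e * e) * v := by rw [hvw]; noncomm_ring
      _ = w * e * v := by rw [he']
  · rw [hwe]; noncomm_ring
  · linear_combination (norm := noncomm_ring) hwe' * v - hwv

/-- Idempotents of an exchange ring lift modulo the Jacobson radical. -/
theorem IsExchangeRing.exists_isIdempotentElem_sub_mem (h : IsExchangeRing R) {a : R}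
    (ha : a ^ 2 - a ∈ jacobsonRadical R) :
    ∃ e : R, IsIdempotentElem e ∧ e - a ∈ jacobsonRadical R := by
  obtain ⟨e, he, ⟨r, hr⟩, ⟨s, hs⟩⟩ := h a
  refine ⟨e, he, ?_⟩
  have h1 : e - a = -((a ^ 2 - a) * r) + (a ^ 2 - a) * s := by
    have e1 : (a ^ 2 - a) * r = a * e - e := by rw [hr]; noncomm_ring
    have e2 : (a ^ 2 - a) * s = -(a * (1 - e)) := by rw [hs]; noncomm_ring
    rw [e1, e2]; noncomm_ring
  rw [h1]
  exact TwoSidedIdeal.add_mem _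
    (TwoSidedIdeal.neg_mem _ (TwoSidedIdeal.mul_mem_right _ _ _ ha))
    (TwoSidedIdeal.mul_mem_right _ _ _ ha)

/-- In an exchange ring, an element lies in the Jacobson radical as soon as the right ideal it
generates contains no nonzero idempotent. -/
theorem IsExchangeRing.mem_jacobsonRadical (h : IsExchangeRing R) {a : R}
    (ha : ∀ r, IsIdempotentElem (a * r) → a * r = 0) : a ∈ jacobsonRadical R := by
  have key : ∀ r, ∃ t, (1 - a * r) * t = 1 := fun r ↦ by
    obtain ⟨e, he, ⟨x, hx⟩, ⟨s, hs⟩⟩ := h (a * r)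
    rw [mul_assoc] at hx
    rw [hx] at he hs
    rw [ha _ he, sub_zero] at hs
    exact ⟨s, hs.symm⟩
  refine mem_jacobsonRadical_of_forall_isUnit fun r ↦ isUnit_one_sub_mul_swap ?_
  obtain ⟨t, ht⟩ := key r
  obtain ⟨c, hc⟩ := key (-(r * t))
  have htc : t * c = 1 := by
    linear_combination (norm := noncomm_ring) hc + ht * c
  have hct : c = 1 - a * r := (left_inv_eq_right_inv ht htc).symm
  exact isUnit_iff_exists.2 ⟨t, ht, hct ▸ htc⟩

end Implications

namespace IsNDeltaU

variable {R : Type*} [Ring R] {n : ℕ}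

theorem two_mem (h : IsNDeltaU R n) (hn : Odd n) : (2 : R) ∈ Delta R := by
  have := Delta.neg_mem (h (-1))
  rw [Units.val_neg, Units.val_one, hn.neg_one_pow] at this
  convert this using 1
  norm_num

theorem mem_Delta_of_mul_self_eq_zero (h : IsNDeltaU R n) (hn : Odd n) {a : R}
    (ha : a * a = 0) : a ∈ Delta R := by
  have hu : IsUnit (1 + a) := isUnit_iff_exists.2 ⟨1 - a,
    by linear_combination (norm := noncomm_ring) -ha,
    by linear_combination (norm := noncomm_ring) -ha⟩
  have hpow : ∀ m : ℕ, (1 + a) ^ m = 1 + m * a := fun m ↦ by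
    induction m with
    | zero => simp
    | succ m ih =>
      rw [pow_succ, ih, Nat.cast_succ]
      linear_combination (norm := noncomm_ring) (m : R) * ha
  have h1 := h hu.unit
  rw [IsUnit.unit_spec, hpow, add_sub_cancel_left] at h1
  obtain ⟨m, rfl⟩ := hn
  have h2 := Delta.natCast_mul_mem (h.two_mem ⟨m, rfl⟩) m
  have h3 := Delta.sub_mem (Delta.mul_unit_mem h2 hu) h2
  convert Delta.sub_mem h1 h3 using 1
  push_cast
  rw [(Nat.cast_commute m (2 : R)).eq]
  noncomm_ring

theorem mem_jacobsonRadical_of_mul_self_eq_zero (h : IsNDeltaU R n) (hn : Odd n)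
    (hR : IsExchangeRing R) {a : R} (ha : a * a = 0) : a ∈ jacobsonRadical R := by
  refine hR.mem_jacobsonRadical fun r he ↦ ?_
  set e := a * r with hr
  have hae : a * e = 0 := by rw [hr, ← mul_assoc, ha, zero_mul]
  have hea : (1 - e) * e = 0 := by rw [sub_mul, one_mul, he.eq, sub_self]
  have hp : e * a * (1 - e) ∈ Delta R := h.mem_Delta_of_mul_self_eq_zero hn (by
    calc e * a * (1 - e) * (e * a * (1 - e)) = e * a * ((1 - e) * e) * a * (1 - e) := by
          noncomm_ring
      _ = 0 := by rw [hea]; simp)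
  have hq : (1 - e) * r * e ∈ Delta R := h.mem_Delta_of_mul_self_eq_zero hn (by
    calc (1 - e) * r * e * ((1 - e) * r * e) = (1 - e) * r * (e - e * e) * r * e := by
          noncomm_ring
      _ = 0 := by rw [he.eq]; simp)
  have hpq : e * a * (1 - e) * ((1 - e) * r * e) = e := by
    calc e * a * (1 - e) * ((1 - e) * r * e)
        = e * (a * r) * e - e * (a * e) * (2 - e) * r * e := by noncomm_ring
      _ = e := by rw [hae, ← hr, he.eq, he.eq]; simp
  exact he.eq_zero_of_isUnit_one_sub
    (Delta.isUnit_sub (hpq ▸ Delta.mul_mem hp hq) isUnit_one)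

/-- Idempotents are central modulo the Jacobson radical. -/
theorem modJacobson_commute (h : IsNDeltaU R n) (hn : Odd n) (hR : IsExchangeRing R) {e : R}
    (he : IsIdempotentElem e) (x : R) : Commute (modJacobson R e) (modJacobson R x) := by
  have he' := he.eq
  have h1 : e * x * (1 - e) ∈ jacobsonRadical R :=
    h.mem_jacobsonRadical_of_mul_self_eq_zero hn hR (by
      calc e * x * (1 - e) * (e * x * (1 - e)) = e * x * (e - e * e) * x * (1 - e) := by
            noncomm_ring
        _ = 0 := by rw [he']; simp)
  have h2 : (1 - e) * x * e ∈ jacobsonRadical R :=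
    h.mem_jacobsonRadical_of_mul_self_eq_zero hn hR (by
      calc (1 - e) * x * e * ((1 - e) * x * e) = (1 - e) * x * (e - e * e) * x * e := by
            noncomm_ring
        _ = 0 := by rw [he']; simp)
  rw [← modJacobson_eq_zero_iff] at h1 h2
  have h3 : modJacobson R (e * x - x * e) = 0 := by
    have : e * x - x * e = e * x * (1 - e) - (1 - e) * x * e := by noncomm_ring
    rw [this, map_sub, h1, h2, sub_zero]
  rw [map_sub, map_mul, map_mul, sub_eq_zero] at h3
  exact h3

theorem isCleanRing (h : IsNDeltaU R n) (hn : Odd n) (hR : IsExchangeRing R) :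
    IsCleanRing R := by
  intro a
  obtain ⟨e, he, ⟨r, hr⟩, ⟨s, hs⟩⟩ := hR a
  refine ⟨1 - e, a - (1 - e), he.one_sub, ?_, by abel⟩
  set c := a - (1 - e) with hc
  set q := modJacobson R
  have hcomm : ∀ x, q e * q x = q x * q e := fun x ↦ (h.modJacobson_commute hn hR he x).eq
  have hone : q (c * (r * e - s * (1 - e))) = 1 := by
    have h1 : q e = q a * q r := by rw [← map_mul, ← hr]
    have h2 : 1 - q e = (1 - q a) * q s := by
      rw [← map_one q, ← map_sub, ← map_sub, ← map_mul, ← hs]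
    have h3 : q e * q e = q e := by rw [← map_mul, he.eq]
    have h4 := hcomm r
    have h5 := hcomm s
    simp only [hc, map_mul, map_sub, map_one]
    linear_combination (norm := noncomm_ring) -h1 * q e - h2 * (1 - q e) + (2 : ℤ) • h3 +
      h4 * q e + q r * h3 - h5 * (1 - q e) + q s * h3
  obtain ⟨p, hp, -⟩ := isUnit_iff_exists.1 (isUnit_of_modJacobson_eq_one hone)
  rw [mul_assoc] at hp
  set t := (r * e - s * (1 - e)) * p
  have hg : IsIdempotentElem (1 - t * c) := by
    refine IsIdempotentElem.one_sub ?_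
    calc t * c * (t * c) = t * (c * t) * c := by noncomm_ring
      _ = t * c := by rw [hp, mul_one]
  have hcg : c * (1 - t * c) = 0 := by
    linear_combination (norm := noncomm_ring) -hp * c
  have hgc := (h.modJacobson_commute hn hR hg c).eq
  rw [← map_mul, ← map_mul, hcg, map_zero] at hgc
  refine isUnit_of_isUnit_modJacobson (isUnit_iff_exists.2 ⟨q t, ?_, ?_⟩)
  · rw [← map_mul, hp, map_one]
  · have h1 : q ((1 - t * c) * c * t) = 0 := by rw [map_mul, hgc, zero_mul]
    rw [mul_assoc, hp, mul_one, map_sub, map_one, sub_eq_zero] at h1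
    rw [← map_mul, ← h1]

theorem mem_jacobsonRadical_of_mem_Delta (h : IsNDeltaU R n) (hn : Odd n)
    (hR : IsExchangeRing R) {d : R} (hd : d ∈ Delta R) : d ∈ jacobsonRadical R := by
  refine mem_jacobsonRadical_of_forall_isUnit fun r ↦ ?_
  obtain ⟨e, u, he, hu, rfl⟩ := h.isCleanRing hn hR r
  rw [add_mul, ← sub_sub]
  refine Delta.isUnit_sub (Delta.unit_mul_mem hd hu) (isUnit_of_isUnit_modJacobson ?_)
  obtain ⟨v, h1, h2⟩ := isUnit_iff_exists.1 (Delta.isUnit_sub hd isUnit_one)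
  set q := modJacobson R
  have h3 : q e * q e = q e := by rw [← map_mul, he.eq]
  have h4 : q e * q d = q d * q e := h.modJacobson_commute hn hR he d
  have h5 : q e * q v = q v * q e := h.modJacobson_commute hn hR he v
  have h1' : (1 - q d) * q v = 1 := by rw [← map_one q, ← map_sub, ← map_mul, h1]
  have h2' : q v * (1 - q d) = 1 := by rw [← map_one q, ← map_sub, ← map_mul, h2]
  rw [map_sub, map_mul, map_one]
  refine isUnit_iff_exists.2 ⟨q e * q v + (1 - q e), ?_, ?_⟩
  · linear_combination (norm := noncomm_ring)
      q e * h4 * q v - h3 * q d * q v + q e * h1' - q e * h4 + h3 * q d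
  · linear_combination (norm := noncomm_ring)
      q e * h5 * q d - h3 * q v * q d + q e * h2' + h3 * q d

theorem isSemiregularRing {k : ℕ} (hk : 1 ≤ k) (h : IsNDeltaU R (2 ^ k - 1))
    (hR : IsExchangeRing R) : IsSemiregularRing R := by
  have hn : Odd (2 ^ k - 1) :=
    Nat.Even.sub_odd Nat.one_le_two_pow (even_two.pow_of_ne_zero (by lia)) odd_one
  refine ⟨fun a ↦ ?_, fun a ↦ hR.exists_isIdempotentElem_sub_mem⟩
  obtain ⟨e, u, he, hu, rfl⟩ := h.isCleanRing hn hR a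
  set q := modJacobson R
  have h2 : (2 : (jacobsonRadical R).ringCon.Quotient) = 0 := by
    have := modJacobson_eq_zero_iff.2
      (h.mem_jacobsonRadical_of_mem_Delta hn hR (h.two_mem hn))
    rwa [map_ofNat] at this
  have hqe : q e * q e = q e := by rw [← map_mul, he.eq]
  have hcomm := (h.modJacobson_commute hn hR he u)
  have hpow : ∀ m : ℕ, (q e + q u) ^ 2 ^ m = q e + q u ^ 2 ^ m := fun m ↦ by
    induction m with
    | zero => simp
    | succ m ih =>
      have hc := (hcomm.pow_right (2 ^ m)).eq
      rw [pow_succ, pow_mul, ih, pow_mul, pow_two, pow_two]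
      linear_combination (norm := noncomm_ring) hqe - hc + h2 * (q e * q u ^ 2 ^ m)
  have hun : q u ^ (2 ^ k - 1) = 1 := by
    have := modJacobson_eq_zero_iff.2 (h.mem_jacobsonRadical_of_mem_Delta hn hR (h hu.unit))
    rwa [IsUnit.unit_spec, map_sub, map_pow, map_one, sub_eq_zero] at this
  have hk2 : 2 ≤ 2 ^ k := Nat.le_self_pow (by lia) 2
  refine ⟨(e + u) ^ (2 ^ k - 2), modJacobson_eq_zero_iff.1 ?_⟩
  rw [← pow_succ', ← pow_succ, map_sub, map_pow, map_add, sub_eq_zero,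
    show 2 ^ k - 2 + 1 + 1 = 2 ^ k by lia, hpow]
  congr 1
  rw [show 2 ^ k = (2 ^ k - 1) + 1 by lia, pow_succ, hun, one_mul]

end IsNDeltaU

/-- For a `(2^k - 1)`-ΔU ring (`k ≥ 1`), the following are equivalent:
(i) `R` is semi-regular; (ii) `R` is exchange; (iii) `R` is clean. -/
theorem semiregular_exchange_clean_tfae (R : Type*) [Ring R] (k : ℕ) (hk : 1 ≤ k)
    (h : IsNDeltaU R (2 ^ k - 1)) :
    List.TFAE [IsSemiregularRing R, IsExchangeRing R, IsCleanRing R] := by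
  have hn : Odd (2 ^ k - 1) :=
    Nat.Even.sub_odd Nat.one_le_two_pow (even_two.pow_of_ne_zero (by lia)) odd_one
  tfae_have 1 → 2 := IsSemiregularRing.isExchangeRing
  tfae_have 2 → 1 := h.isSemiregularRing hk
  tfae_have 2 → 3 := h.isCleanRing hn
  tfae_have 3 → 2 := IsCleanRing.isExchangeRing
  tfae_finish
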